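/- Concentration bound for the information distance: in the bandit model, for every δ ≥ |X|·(|𝔯|−1) + 1 and every round t ≥ 1, Prob( Σ_{x∈X} N_t(x)·I(P_t(x),P(x)) ≥ δ ) ≤ e · ( δ·⌈log(t)·δ + 1⌉·2e / (|X|·(|𝔯|−1)) )^{|X|·(|𝔯|−1)} · exp(−δ). -/

import Mathlib

open scoped BigOperators Classical ENNReal
open MeasureTheory

namespace Bandit

section Table

variable {R X : Type*} [Fintype R] [Fintype X] [Nonempty X] [Nonempty R]
  [DecidableEq R] [DecidableEq X]

/-- The probability measure on reward tables `ω : Fin T → X → R` (the reward `ω t x` of arm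
`x` in round `t+1`), given by the product of the reward distributions `P(·, x)`:
independent rewards across arms and rounds. -/
noncomputable def tableMeasure (P : R → X → ℝ) (T : ℕ) :
    @Measure (Fin T → X → R) ⊤ :=
  ∑ ω : Fin T → X → R,
    (∏ t : Fin T, ∏ x : X, ENNReal.ofReal (P (ω t x) x)) • @Measure.dirac _ ⊤ ω

/-- The history `(x₁, R₁(x₁), …, xₙ, Rₙ(xₙ))` of the first `n` rounds, for a policy
`π` choosing the arm of each round measurably from the past history. -/
def histT (π : List (X × R) → X) {T : ℕ} (ω : Fin T → X → R) : ℕ → List (X × R)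
  | 0 => []
  | n + 1 =>
    if hn : n < T then
      histT π ω n ++ [(π (histT π ω n), ω ⟨n, hn⟩ (π (histT π ω n)))]
    else histT π ω n

/-- `N_t(x)`: the number of pulls of arm `x` before round `t`. -/
def pullsT (π : List (X × R) → X) {T : ℕ} (ω : Fin T → X → R) (t : ℕ) (x : X) : ℕ :=
  ((histT π ω (t - 1)).filter fun p => p.1 = x).length

/-- `P_t(r, x)`: the empirical probability of reward `r` on arm `x` before round `t`. -/
noncomputable def empT (π : List (X × R) → X) {T : ℕ} (ω : Fin T → X → R)
    (t : ℕ) (r : R) (x : X) : ℝ :=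
  (((histT π ω (t - 1)).filter fun p => p = (x, r)).length : ℝ) / pullsT π ω t x

end Table

end Bandit

namespace Bandit

/-- Information distance between two nonnegative measures on a finite set. -/
noncomputable def infoDiv {α : Type*} [Fintype α] (M' M : α → ℝ) : EReal :=
  if ∀ a, M a = 0 → M' a = 0 then
    ((∑ a : α, (M' a * Real.log (M' a / M a) - M' a + M a) : ℝ) : EReal)
  else ⊤

/-- The relative entropy of the Bernoulli law of parameter `q` with respect to parameter `p`. -/
noncomputable def bernoulliKL (q p : ℝ) : ℝ :=
  q * Real.log (q / p) + (1 - q) * Real.log ((1 - q) / (1 - p))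

/-- A nonnegative function of the success and failure counts that is a supermartingale under
Bernoulli sampling with parameter `p`. -/
structure IsBernoulliSupermartingale (p : ℝ) (V : ℕ → ℕ → ℝ) : Prop where
  nonneg : ∀ a b, 0 ≤ V a b
  step : ∀ a b, p * V (a + 1) b + (1 - p) * V a (b + 1) ≤ V a b

theorem exp_sub_exp_mul_le {μ s t : ℝ} (hμ0 : 0 ≤ μ) (hμ1 : μ < 1) :
    (Real.exp (μ * t) - Real.exp (μ * s)) * Real.exp (-t) ≤
      μ / (1 - μ) * (Real.exp (-(1 - μ) * s) - Real.exp (-(1 - μ) * t)) := by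
  have h1 : 0 < 1 - μ := by linarith
  have e1 : (Real.exp (μ * t) - Real.exp (μ * s)) * Real.exp (-t) =
      Real.exp (-(1 - μ) * t) * (1 - Real.exp (-(μ * (t - s)))) := by
    rw [sub_mul, mul_sub, ← Real.exp_add, ← Real.exp_add, ← Real.exp_add, mul_one]
    ring_nf
  have e2 : Real.exp (-(1 - μ) * s) - Real.exp (-(1 - μ) * t) =
      Real.exp (-(1 - μ) * t) * (Real.exp ((1 - μ) * (t - s)) - 1) := by
    rw [mul_sub, ← Real.exp_add, mul_one]
    ring_nf
  have h2 := Real.add_one_le_exp (-(μ * (t - s)))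
  have h3 := Real.add_one_le_exp ((1 - μ) * (t - s))
  rw [e1, e2, mul_left_comm]
  refine mul_le_mul_of_nonneg_left ?_ (Real.exp_pos _).le
  calc 1 - Real.exp (-(μ * (t - s))) ≤ μ * (t - s) := by linarith
    _ = μ / (1 - μ) * ((1 - μ) * (t - s)) := by field_simp
    _ ≤ _ := mul_le_mul_of_nonneg_left (by linarith) (div_nonneg hμ0 h1.le)

/-- A discrete form of `exp (μ y) = 1 + ∫₀^y μ exp ((μ - 1) z) exp z dz`. -/
theorem exists_mixture_weights {ι : Type*} [LinearOrder ι] {μ : ℝ} (hμ0 : 0 ≤ μ) (hμ1 : μ < 1)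
    (y : ι → ℝ) (Q : Finset ι) (hy0 : ∀ q ∈ Q, 0 ≤ y q) (hmono : MonotoneOn y Q) :
    ∃ w : ι → ℝ, (∀ q, 0 ≤ w q) ∧ ∑ q ∈ Q, w q ≤ μ / (1 - μ) ∧
      ∀ q' ∈ Q, Real.exp (μ * y q') ≤ 1 + ∑ q ∈ Q with q ≤ q', w q * Real.exp (y q) := by
  have h1 : 0 < 1 - μ := by linarith
  suffices h : ∃ (w : ι → ℝ) (B : ℝ), (B = 0 ∨ ∃ q ∈ Q, B = y q) ∧ (∀ q, 0 ≤ w q) ∧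
      Real.exp (μ * B) ≤ 1 + ∑ q ∈ Q, w q * Real.exp (y q) ∧
      ∑ q ∈ Q, w q ≤ μ / (1 - μ) * (1 - Real.exp (-(1 - μ) * B)) ∧
      ∀ q' ∈ Q, Real.exp (μ * y q') ≤ 1 + ∑ q ∈ Q with q ≤ q', w q * Real.exp (y q) by
    obtain ⟨w, B, -, hw, -, hs, hq⟩ := h
    refine ⟨w, hw, hs.trans ?_, hq⟩
    refine mul_le_of_le_one_right (div_nonneg hμ0 h1.le) ?_
    linarith [Real.exp_pos (-(1 - μ) * B)]
  induction Q using Finset.induction_on_max with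
  | empty => exact ⟨fun _ => 0, 0, by simp⟩
  | insert a s ha ih =>
    obtain ⟨w, B, hB, hw, hBs, hs, hq⟩ := ih (fun q hq => hy0 q (Finset.mem_insert_of_mem hq))
      (hmono.mono (by simp))
    have has : a ∉ s := fun h => lt_irrefl _ (ha a h)
    have hBa : B ≤ y a := by
      rcases hB with rfl | ⟨q, hqs, rfl⟩
      · exact hy0 a (Finset.mem_insert_self _ _)
      · exact hmono (by simp [hqs]) (by simp) (ha q hqs).le
    set wa : ℝ := (Real.exp (μ * y a) - Real.exp (μ * B)) * Real.exp (-y a) with hwa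
    have hwa0 : 0 ≤ wa := mul_nonneg
      (sub_nonneg.2 (Real.exp_le_exp.2 (mul_le_mul_of_nonneg_left hBa hμ0))) (Real.exp_pos _).le
    have hupd : ∀ q ∈ s, Function.update w a wa q = w q := fun q hqs =>
      Function.update_of_ne (ha q hqs).ne _ _
    have hwae : wa * Real.exp (y a) = Real.exp (μ * y a) - Real.exp (μ * B) := by
      rw [hwa, mul_assoc, ← Real.exp_add]; simp
    have htot : Real.exp (μ * y a) ≤
        1 + ∑ q ∈ insert a s, Function.update w a wa q * Real.exp (y q) := by
      rw [Finset.sum_insert has, Function.update_self, hwae,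
        Finset.sum_congr rfl fun q hqs => by rw [hupd q hqs]]
      linarith
    refine ⟨Function.update w a wa, y a, Or.inr ⟨a, by simp, rfl⟩, ?_, htot, ?_, ?_⟩
    · intro q
      rcases eq_or_ne q a with rfl | h
      · simpa using hwa0
      · simpa [h] using hw q
    · rw [Finset.sum_insert has, Function.update_self, Finset.sum_congr rfl hupd]
      have := exp_sub_exp_mul_le (s := B) (t := y a) hμ0 hμ1
      rw [← hwa] at this
      linarith
    · intro q' hq'
      rcases Finset.mem_insert.1 hq' with rfl | hq's
      · rwa [Finset.filter_true_of_mem]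
        intro q hqs
        rcases Finset.mem_insert.1 hqs with rfl | h
        · exact le_rfl
        · exact (ha q h).le
      · rw [Finset.filter_insert, if_neg (ha q' hq's).not_ge]
        refine (hq q' hq's).trans_eq ?_
        congr 1
        exact Finset.sum_congr rfl fun q hqs => by rw [hupd q (Finset.mem_filter.1 hqs).1]

theorem sub_le_mul_log_div {u v : ℝ} (hu : 0 ≤ u) (hv : 0 < v) :
    u - v ≤ u * Real.log (u / v) := by
  rcases hu.eq_or_lt with rfl | hu
  · simpa using hv.le
  · have := Real.one_sub_inv_le_log_of_pos (div_pos hu hv)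
    calc u - v = u * (1 - (u / v)⁻¹) := by field_simp
      _ ≤ _ := mul_le_mul_of_nonneg_left this hu.le

theorem bernoulliKL_mono {p q q' : ℝ} (hp0 : 0 < p) (hp1 : p < 1) (hpq : p ≤ q) (hqq : q ≤ q')
    (hq1 : q' ≤ 1) : bernoulliKL q p ≤ bernoulliKL q' p := by
  rcases (hqq.trans hq1).eq_or_lt with h | hq
  · obtain rfl : q = q' := by linarith
    rfl
  have hq0 : 0 < q := hp0.trans_le hpq
  have hlog {u v w : ℝ} (hu : 0 ≤ u) (hv : 0 < v) (hw : 0 < w) :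
      u * Real.log (u / w) = u * Real.log (u / v) + u * Real.log (v / w) := by
    rcases hu.eq_or_lt with rfl | hu
    · simp
    · rw [Real.log_div hu.ne' hw.ne', Real.log_div hu.ne' hv.ne', Real.log_div hv.ne' hw.ne']
      ring
  have e1 := hlog (hq0.le.trans hqq) hq0 hp0
  have e2 := hlog (sub_nonneg.2 hq1) (sub_pos.2 hq) (sub_pos.2 hp1)
  have g1 := sub_le_mul_log_div (hq0.le.trans hqq) hq0
  have g2 := sub_le_mul_log_div (sub_nonneg.2 hq1) (sub_pos.2 hq)
  have l1 : 0 ≤ Real.log (q / p) := Real.log_nonneg ((one_le_div hp0).2 hpq)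
  have l2 : Real.log ((1 - q) / (1 - p)) ≤ 0 :=
    Real.log_nonpos (div_nonneg (by linarith) (by linarith))
      ((div_le_one (by linarith)).2 (by linarith))
  have k1 := mul_nonneg (sub_nonneg.2 hqq) l1
  have k2 := mul_nonneg (sub_nonneg.2 hqq) (neg_nonneg.2 l2)
  unfold bernoulliKL
  rw [e1, e2]
  linarith

theorem bernoulliKL_nonneg {p q : ℝ} (hp0 : 0 < p) (hp1 : p < 1) (hpq : p ≤ q) (hq1 : q ≤ 1) :
    0 ≤ bernoulliKL q p := by
  have h : bernoulliKL p p = 0 := by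
    simp [bernoulliKL, div_self hp0.ne', div_self (sub_pos.2 hp1).ne']
  exact h.ge.trans (bernoulliKL_mono hp0 hp1 le_rfl hpq hq1)

/-- The likelihood ratio of parameter `q` against `p` is large when the empirical mean is
beyond `q`. -/
theorem exp_mul_bernoulliKL_le {p q : ℝ} (hp0 : 0 < p) (hp1 : p < 1) (hpq : p ≤ q) {a b : ℕ}
    (hab : 0 < a + b) (hq : q ≤ (a : ℝ) / (a + b)) :
    Real.exp ((a + b) * bernoulliKL q p) ≤ (q / p) ^ a * ((1 - q) / (1 - p)) ^ b := by
  have hq0 : 0 < q := hp0.trans_le hpq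
  have hn : (0 : ℝ) < a + b := by exact_mod_cast hab
  have hqa : q * (a + b) ≤ a := (le_div_iff₀ hn).1 hq
  have hl1 : 0 ≤ Real.log (q / p) := Real.log_nonneg ((one_le_div hp0).2 hpq)
  have hq1 : q ≤ 1 := hq.trans ((div_le_one hn).2 (by linarith [Nat.cast_nonneg (α := ℝ) b]))
  have e1 : (q / p) ^ a = Real.exp (a * Real.log (q / p)) := by
    rw [Real.exp_nat_mul, Real.exp_log (div_pos hq0 hp0)]
  rcases hq1.eq_or_lt with rfl | hq1
  · obtain rfl : b = 0 := by
      have : (b : ℝ) ≤ 0 := by linarith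
      exact_mod_cast this.antisymm (Nat.cast_nonneg b)
    rw [e1]
    simp [bernoulliKL]
  have hl2 : Real.log ((1 - q) / (1 - p)) ≤ 0 :=
    Real.log_nonpos (div_nonneg (by linarith) (by linarith))
      ((div_le_one (by linarith)).2 (by linarith))
  have e2 : ((1 - q) / (1 - p)) ^ b = Real.exp (b * Real.log ((1 - q) / (1 - p))) := by
    rw [Real.exp_nat_mul, Real.exp_log (div_pos (by linarith) (by linarith))]
  rw [e1, e2, ← Real.exp_add, Real.exp_le_exp]
  have k1 := mul_nonneg (sub_nonneg.2 hqa) hl1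
  have k2 := mul_nonneg (sub_nonneg.2 hqa) (neg_nonneg.2 hl2)
  unfold bernoulliKL
  nlinarith

/-- One-sided mixture supermartingale for sample sizes between `M / ρ` and `M`. -/
theorem exists_oneSided_supermartingale {μ ρ M p : ℝ} (hμ0 : 0 ≤ μ) (hμ1 : μ < 1) (hρ : 1 < ρ)
    (hM : 0 < M) (hp0 : 0 < p) (hp1 : p < 1) :
    ∃ V : ℕ → ℕ → ℝ, IsBernoulliSupermartingale p V ∧ (∀ a b, 1 ≤ V a b) ∧
      V 0 0 ≤ 1 / (1 - μ) ∧
      ∀ a b : ℕ, 0 < a + b → M / ρ ≤ a + b → (a + b : ℝ) ≤ M → p * (a + b) ≤ a →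
        Real.exp (μ / ρ * ((a + b) * bernoulliKL (a / (a + b)) p)) ≤ V a b := by
  have hρ0 : 0 < ρ := by linarith
  set m : ℕ := ⌊M⌋₊
  let Q : Finset ℝ := ((Finset.range (m + 1) ×ˢ Finset.range (m + 1)).image
    fun c : ℕ × ℕ => (c.1 : ℝ) / (c.1 + c.2)).filter fun q => p ≤ q ∧ q ≤ 1
  have hQ : ∀ q ∈ Q, p ≤ q ∧ q ≤ 1 := fun q hq => (Finset.mem_filter.1 hq).2
  obtain ⟨w, hw0, hws, hw⟩ := exists_mixture_weights hμ0 hμ1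
    (fun q => M / ρ * bernoulliKL q p) Q
    (fun q hq => mul_nonneg (div_pos hM hρ0).le
      (bernoulliKL_nonneg hp0 hp1 (hQ q hq).1 (hQ q hq).2))
    (fun q hq q' hq' h => mul_le_mul_of_nonneg_left
      (bernoulliKL_mono hp0 hp1 (hQ q hq).1 h (hQ q' hq').2) (div_pos hM hρ0).le)
  have hnn : ∀ q ∈ Q, ∀ a b : ℕ, 0 ≤ w q * ((q / p) ^ a * ((1 - q) / (1 - p)) ^ b) := by
    intro q hq a b
    have h1 : 0 ≤ q / p := div_nonneg (by linarith [(hQ q hq).1]) hp0.le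
    have h2 : 0 ≤ (1 - q) / (1 - p) := div_nonneg (by linarith [(hQ q hq).2]) (by linarith)
    have := hw0 q
    positivity
  have hV1 : ∀ a b : ℕ, 1 ≤ 1 + ∑ q ∈ Q, w q * ((q / p) ^ a * ((1 - q) / (1 - p)) ^ b) :=
    fun a b => le_add_of_nonneg_right (Finset.sum_nonneg fun q hq => hnn q hq a b)
  refine ⟨fun a b => 1 + ∑ q ∈ Q, w q * ((q / p) ^ a * ((1 - q) / (1 - p)) ^ b),
    ⟨fun a b => zero_le_one.trans (hV1 a b), fun a b => ?_⟩, hV1, ?_, ?_⟩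
  · have h1p : 1 - p ≠ 0 := by linarith
    have : ∀ q, w q * ((q / p) ^ a * ((1 - q) / (1 - p)) ^ b) =
        p * (w q * ((q / p) ^ (a + 1) * ((1 - q) / (1 - p)) ^ b)) +
        (1 - p) * (w q * ((q / p) ^ a * ((1 - q) / (1 - p)) ^ (b + 1))) := by
      intro q
      have : p * (q / p) + (1 - p) * ((1 - q) / (1 - p)) = 1 := by
        field_simp
        ring
      rw [pow_succ, pow_succ]
      linear_combination -(w q * ((q / p) ^ a * ((1 - q) / (1 - p)) ^ b)) * this
    rw [Finset.sum_congr rfl fun q _ => this q, Finset.sum_add_distrib, ← Finset.mul_sum,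
      ← Finset.mul_sum]
    linarith
  · have : 1 / (1 - μ) = 1 + μ / (1 - μ) := by
      have : 1 - μ ≠ 0 := by linarith
      field_simp
      ring
    simpa [this] using hws
  · intro a b hab hMa haM hpa
    have hn : (0 : ℝ) < a + b := by exact_mod_cast hab
    set q' : ℝ := a / (a + b) with hq'
    have hpq' : p ≤ q' := (le_div_iff₀ hn).2 hpa
    have hq'1 : q' ≤ 1 := (div_le_one hn).2 (by linarith [Nat.cast_nonneg (α := ℝ) b])
    have hab_le : a + b ≤ m := Nat.le_floor (by exact_mod_cast haM)
    have hmem : q' ∈ Q := by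
      refine Finset.mem_filter.2 ⟨Finset.mem_image.2 ⟨(a, b), ?_, rfl⟩, hpq', hq'1⟩
      simp only [Finset.mem_product, Finset.mem_range]
      omega
    have hkl := bernoulliKL_nonneg hp0 hp1 hpq' hq'1
    calc Real.exp (μ / ρ * ((a + b) * bernoulliKL q' p))
        ≤ Real.exp (μ * (M / ρ * bernoulliKL q' p)) := by
          rw [Real.exp_le_exp]
          calc μ / ρ * ((a + b) * bernoulliKL q' p) ≤ μ / ρ * (M * bernoulliKL q' p) := by gcongr
            _ = _ := by ring
      _ ≤ _ := hw q' hmem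
      _ ≤ 1 + ∑ q ∈ Q with q ≤ q', w q * ((q / p) ^ a * ((1 - q) / (1 - p)) ^ b) := by
          gcongr with q hq
          · exact hw0 q
          obtain ⟨hqQ, hqq⟩ := Finset.mem_filter.1 hq
          refine le_trans ?_ (exp_mul_bernoulliKL_le hp0 hp1 (hQ q hqQ).1 hab hqq)
          rw [Real.exp_le_exp]
          exact mul_le_mul_of_nonneg_right hMa
            (bernoulliKL_nonneg hp0 hp1 (hQ q hqQ).1 (hQ q hqQ).2)
      _ ≤ _ := by
          refine add_le_add le_rfl (Finset.sum_le_sum_of_subset_of_nonneg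
            (Finset.filter_subset _ _) fun q hq _ => hnn q hq a b)

/-- For every Bernoulli parameter there is a supermartingale started below `C` that dominates the
exponential of `c` times the deviation, as long as the sample size is less than `T`. -/
def BernoulliDeviationBound (c C : ℝ) (T : ℕ) : Prop :=
  ∀ p : ℝ, 0 < p → p < 1 → ∃ B : ℕ → ℕ → ℝ, IsBernoulliSupermartingale p B ∧ B 0 0 ≤ C ∧
    ∀ a b : ℕ, a + b < T → Real.exp (c * ((a + b) * bernoulliKL (a / (a + b)) p)) ≤ B a b

/-- Peeling of the sample size along the powers of `ρ`. -/
theorem bernoulliDeviationBound_of_le_pow {μ ρ : ℝ} (hμ0 : 0 ≤ μ) (hμ1 : μ < 1) (hρ : 1 < ρ)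
    {D T : ℕ} (hD : 0 < D) (hT : (T : ℝ) ≤ ρ ^ D) :
    BernoulliDeviationBound (μ / ρ) (2 * D / (1 - μ)) T := by
  intro p hp0 hp1
  have hρ0 : 0 < ρ := by linarith
  choose U hU hU1 hU0 hUe using fun i : ℕ =>
    exists_oneSided_supermartingale hμ0 hμ1 hρ (pow_pos hρ0 (i + 1)) hp0 hp1
  choose L hL _ hL0 hLe using fun i : ℕ =>
    exists_oneSided_supermartingale hμ0 hμ1 hρ (pow_pos hρ0 (i + 1)) (sub_pos.2 hp1)
      (sub_lt_self 1 hp0)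
  have hnn : ∀ a b i, 0 ≤ U i a b + L i b a := fun a b i =>
    add_nonneg ((hU i).nonneg a b) ((hL i).nonneg b a)
  refine ⟨fun a b => ∑ i ∈ Finset.range D, (U i a b + L i b a),
    ⟨fun a b => Finset.sum_nonneg fun i _ => hnn a b i, fun a b => ?_⟩, ?_, ?_⟩
  · rw [Finset.mul_sum, Finset.mul_sum, ← Finset.sum_add_distrib]
    refine Finset.sum_le_sum fun i _ => ?_
    have h1 := (hU i).step a b
    have h2 := (hL i).step b a
    linarith
  · calc ∑ i ∈ Finset.range D, (U i 0 0 + L i 0 0)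
        ≤ ∑ i ∈ Finset.range D, (1 / (1 - μ) + 1 / (1 - μ)) :=
          Finset.sum_le_sum fun i _ => add_le_add (hU0 i) (hL0 i)
      _ = 2 * D / (1 - μ) := by
          rw [Finset.sum_const, Finset.card_range, nsmul_eq_mul]
          ring
  · intro a b hab
    rcases Nat.eq_zero_or_pos (a + b) with h0 | hpos
    · obtain ⟨rfl, rfl⟩ : a = 0 ∧ b = 0 := by omega
      calc Real.exp _ = 1 := by simp
        _ ≤ U 0 0 0 + L 0 0 0 := by linarith [hU1 0 0 0, (hL 0).nonneg 0 0]
        _ ≤ _ := Finset.single_le_sum (f := fun i => U i 0 0 + L i 0 0)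
          (fun i _ => hnn 0 0 i) (Finset.mem_range.2 hD)
    have hn : (0 : ℝ) < a + b := by exact_mod_cast hpos
    have hn1 : (1 : ℝ) ≤ a + b := by exact_mod_cast hpos
    obtain ⟨i, hi1, hi2⟩ := exists_nat_pow_near hn1 hρ
    have hiD : i < D := by
      have : ρ ^ i < ρ ^ D := hi1.trans_lt (lt_of_lt_of_le (by exact_mod_cast hab) hT)
      exact (pow_lt_pow_iff_right₀ hρ).1 this
    have hM : ρ ^ (i + 1) / ρ ≤ a + b := by
      rwa [pow_succ, mul_div_assoc, div_self hρ0.ne', mul_one]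
    refine le_trans ?_ (Finset.single_le_sum (f := fun i => U i a b + L i b a)
      (fun i _ => hnn a b i) (Finset.mem_range.2 hiD))
    rcases le_total (p * (a + b)) a with h | h
    · exact (hUe i a b hpos hM hi2.le h).trans (le_add_of_nonneg_right ((hL i).nonneg b a))
    · have hba : (b : ℝ) + a = a + b := add_comm _ _
      have key := hLe i b a (by omega) (by rwa [hba]) (by rw [hba]; exact hi2.le) (by linarith)
      have hsymm : bernoulliKL (b / (b + a)) (1 - p) = bernoulliKL (a / (a + b)) p := by
        have : (b : ℝ) / (b + a) = 1 - a / (a + b) := by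
          rw [add_comm (b : ℝ)]
          field_simp
          ring
        rw [this]
        unfold bernoulliKL
        rw [sub_sub_cancel, sub_sub_cancel, add_comm]
      rw [hsymm, add_comm (b : ℝ)] at key
      exact key.trans (le_add_of_nonneg_left ((hU i).nonneg a b))

/-- Sample size times relative entropy, for the counts `n` restricted to the outcomes in `S`
and the weights `P`, normalized on `S`. -/
noncomputable def countDiv {R : Type*} (P : R → ℝ) (S : Finset R) (n : R → ℕ) : ℝ :=
  ∑ r ∈ S, (n r : ℝ) * Real.log (n r / P r) -
    (∑ r ∈ S, (n r : ℝ)) * Real.log ((∑ r ∈ S, (n r : ℝ)) / ∑ r ∈ S, P r)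

theorem mul_log_div_add {a b u v : ℝ} (ha : 0 ≤ a) (hb : 0 ≤ b) (hu : 0 < u) (hv : 0 < v) :
    (a + b) * bernoulliKL (a / (a + b)) (u / (u + v)) =
      a * Real.log (a / u) + b * Real.log (b / v) -
        (a + b) * Real.log ((a + b) / (u + v)) := by
  rcases (add_nonneg ha hb).eq_or_lt with h | h
  · obtain rfl : a = 0 := by linarith
    obtain rfl : b = 0 := by linarith
    simp
  have huv : 0 < u + v := add_pos hu hv
  have e1 : 1 - a / (a + b) = b / (a + b) := by field_simp; ring
  have e2 : 1 - u / (u + v) = v / (u + v) := by field_simp; ring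
  have e {x w : ℝ} (hx : 0 ≤ x) (hw : 0 < w) :
      (a + b) * (x / (a + b) * Real.log (x / (a + b) / (w / (u + v)))) =
        x * Real.log (x / w) - x * Real.log ((a + b) / (u + v)) := by
    rcases hx.eq_or_lt with rfl | hx
    · simp
    rw [div_div_div_eq, Real.log_div (by positivity) (by positivity),
      Real.log_mul hx.ne' huv.ne', Real.log_mul h.ne' hw.ne', Real.log_div hx.ne' hw.ne',
      Real.log_div h.ne' huv.ne']
    field_simp
    ring
  unfold bernoulliKL
  rw [e1, e2, mul_add, e ha hu, e hb hv]
  ring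

theorem countDiv_cons {R : Type*} {P : R → ℝ} {S : Finset R} {a : R} (ha : a ∉ S)
    (hPa : 0 < P a) (hPS : 0 < ∑ r ∈ S, P r) (n : R → ℕ) :
    countDiv P (S.cons a ha) n = countDiv P S n +
      (n a + ∑ r ∈ S, (n r : ℝ)) * bernoulliKL (n a / (n a + ∑ r ∈ S, (n r : ℝ)))
        (P a / (P a + ∑ r ∈ S, P r)) := by
  rw [mul_log_div_add (Nat.cast_nonneg _) (Finset.sum_nonneg fun r _ => Nat.cast_nonneg _) hPa hPS]
  simp only [countDiv, Finset.sum_cons]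
  ring

/-- A multinomial deviation supermartingale, from the chain of the Bernoulli experiments
between outcome `a` and the later outcomes. -/
theorem BernoulliDeviationBound.exists_multinomial {R : Type*} [DecidableEq R] {c C : ℝ} {T : ℕ}
    (hB : BernoulliDeviationBound c C T) (hC : 1 ≤ C) (P : R → ℝ) {S : Finset R}
    (hS : S.Nonempty) (hP : ∀ r ∈ S, 0 < P r) :
    ∃ G : (R → ℕ) → ℝ, (∀ n, 0 ≤ G n) ∧ (∀ r ∉ S, ∀ n, G (n + Pi.single r 1) = G n) ∧
      (∀ n, ∑ r ∈ S, P r * G (n + Pi.single r 1) ≤ (∑ r ∈ S, P r) * G n) ∧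
      G 0 ≤ C ^ (S.card - 1) ∧
      ∀ n : R → ℕ, ∑ r ∈ S, n r < T → Real.exp (c * countDiv P S n) ≤ G n := by
  induction hS using Finset.Nonempty.cons_induction with
  | singleton a =>
    refine ⟨fun _ => 1, fun _ => zero_le_one, fun _ _ _ => rfl, fun n => by simp, by simp,
      fun n _ => by simp [countDiv]⟩
  | cons a S ha hS ih =>
    obtain ⟨G, hG0, hGinv, hGstep, hGzero, hGexp⟩ := ih fun r hr => hP r (by simp [hr])
    have hPa : 0 < P a := hP a (by simp)
    have hPS : 0 < ∑ r ∈ S, P r := Finset.sum_pos (fun r hr => hP r (by simp [hr])) hS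
    have hsum : 0 < P a + ∑ r ∈ S, P r := add_pos hPa hPS
    obtain ⟨B, hBs, hBzero, hBexp⟩ := hB (P a / (P a + ∑ r ∈ S, P r)) (div_pos hPa hsum)
      ((div_lt_one hsum).2 (by linarith))
    refine ⟨fun n => G n * B (n a) (∑ r ∈ S, n r), fun n => mul_nonneg (hG0 n) (hBs.nonneg _ _),
      ?_, ?_, ?_, ?_⟩
    · intro r hr n
      have hra : r ≠ a := fun h => hr (by simp [h])
      have hrS : r ∉ S := fun h => hr (by simp [h])
      have : ∑ s ∈ S, (n + Pi.single r 1 : R → ℕ) s = ∑ s ∈ S, n s :=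
        Finset.sum_congr rfl fun s hs => by
          simp [Pi.single_eq_of_ne (show s ≠ r from fun h => hrS (h ▸ hs))]
      simp only [hGinv r hrS, this]
      simp [Pi.single_eq_of_ne hra.symm]
    · intro n
      have hSa : ∑ s ∈ S, (n + Pi.single a 1 : R → ℕ) s = ∑ s ∈ S, n s :=
        Finset.sum_congr rfl fun s hs => by
          simp [Pi.single_eq_of_ne (show s ≠ a from fun h => ha (h ▸ hs))]
      have hSr : ∀ r ∈ S, ∑ s ∈ S, (n + Pi.single r 1 : R → ℕ) s = ∑ s ∈ S, n s + 1 := by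
        intro r hr
        simp [Finset.sum_add_distrib, Finset.sum_pi_single', hr]
      have hra : ∀ r ∈ S, (n + Pi.single r 1 : R → ℕ) a = n a := by
        intro r hr
        simp [Pi.single_eq_of_ne (show a ≠ r from fun h => ha (h ▸ hr))]
      have hstep := hBs.step (n a) (∑ r ∈ S, n r)
      have e : (P a + ∑ r ∈ S, P r) * (P a / (P a + ∑ r ∈ S, P r) * B (n a + 1) (∑ r ∈ S, n r) +
          (1 - P a / (P a + ∑ r ∈ S, P r)) * B (n a) (∑ r ∈ S, n r + 1)) =
          P a * B (n a + 1) (∑ r ∈ S, n r) + (∑ r ∈ S, P r) * B (n a) (∑ r ∈ S, n r + 1) := by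
        field_simp
        ring
      have hstep' := mul_le_mul_of_nonneg_left hstep hsum.le
      rw [e] at hstep'
      beta_reduce
      have hlater : ∑ r ∈ S, P r * (G (n + Pi.single r 1) *
          B ((n + Pi.single r 1 : R → ℕ) a) (∑ s ∈ S, (n + Pi.single r 1 : R → ℕ) s)) =
          (∑ r ∈ S, P r * G (n + Pi.single r 1)) * B (n a) (∑ s ∈ S, n s + 1) := by
        rw [Finset.sum_mul]
        exact Finset.sum_congr rfl fun r hr => by rw [hSr r hr, hra r hr, mul_assoc]
      rw [Finset.sum_cons, Finset.sum_cons, hGinv a ha, hSa, hlater]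
      have h1 := mul_le_mul_of_nonneg_right (hGstep n) (hBs.nonneg (n a) (∑ r ∈ S, n r + 1))
      have h2 := mul_le_mul_of_nonneg_left hstep' (hG0 n)
      have h3 : (n + Pi.single a 1 : R → ℕ) a = n a + 1 := by simp
      rw [h3]
      linarith
    · have hpow : C ^ ((S.cons a ha).card - 1) = C ^ (S.card - 1) * C := by
        rw [Finset.card_cons, ← pow_succ]
        congr 1
        have := hS.card_pos
        omega
      rw [hpow]
      simp only [Pi.zero_apply, Finset.sum_const_zero]
      exact mul_le_mul hGzero hBzero (hBs.nonneg _ _) (pow_nonneg (by linarith) _)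
    · intro n hn
      rw [Finset.sum_cons] at hn
      rw [countDiv_cons ha hPa hPS, mul_add, Real.exp_add]
      have := hBexp (n a) (∑ r ∈ S, n r) hn
      push_cast at this
      exact mul_le_mul (hGexp n (by omega)) this (Real.exp_pos _).le (hG0 n)

section Expectation

variable {R X : Type*}

theorem histT_cons (π : List (X × R) → X) {T : ℕ} (v : X → R) (ω : Fin T → X → R) (n : ℕ) :
    histT π (Fin.cons v ω : Fin (T + 1) → X → R) (n + 1) =
      (π [], v (π [])) :: histT (fun h => π ((π [], v (π [])) :: h)) ω n := by
  induction n with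
  | zero => simp [histT]
  | succ n ih =>
    rw [histT, ih, histT]
    by_cases hn : n < T
    · have h2 : (⟨n + 1, Nat.succ_lt_succ hn⟩ : Fin (T + 1)) = Fin.succ ⟨n, hn⟩ := rfl
      rw [dif_pos (Nat.succ_lt_succ hn), dif_pos hn, List.cons_append, h2, Fin.cons_succ]
    · rw [dif_neg (by omega), dif_neg hn]

theorem histT_length_le (π : List (X × R) → X) {T : ℕ} (ω : Fin T → X → R) (n : ℕ) :
    (histT π ω n).length ≤ n := by
  induction n with
  | zero => simp [histT]
  | succ n ih =>
    rw [histT]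
    split_ifs
    · simpa using ih
    · omega

variable [Fintype X]

/-- The probability of a reward table. -/
def tableWeight (P : R → X → ℝ) {T : ℕ} (ω : Fin T → X → R) : ℝ :=
  ∏ s : Fin T, ∏ x : X, P (ω s x) x

theorem tableWeight_nonneg {P : R → X → ℝ} (hP0 : ∀ r x, 0 ≤ P r x) {T : ℕ}
    (ω : Fin T → X → R) : 0 ≤ tableWeight P ω :=
  Finset.prod_nonneg fun _ _ => Finset.prod_nonneg fun _ _ => hP0 _ _

/-- Rewards of probability zero occur only in tables of probability zero. -/
theorem pos_of_mem_histT {P : R → X → ℝ} (hP0 : ∀ r x, 0 ≤ P r x) (π : List (X × R) → X)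
    {T : ℕ} {ω : Fin T → X → R} (hω : tableWeight P ω ≠ 0) (n : ℕ) :
    ∀ c ∈ histT π ω n, 0 < P c.2 c.1 := by
  induction n with
  | zero => simp [histT]
  | succ n ih =>
    intro c hc
    rw [histT] at hc
    split_ifs at hc with hn
    · rcases List.mem_append.1 hc with h | h
      · exact ih c h
      · rw [List.mem_singleton.1 h]
        refine (hP0 _ _).lt_of_ne' ?_
        have h1 := Finset.prod_ne_zero_iff.1 hω ⟨n, hn⟩ (Finset.mem_univ _)
        exact Finset.prod_ne_zero_iff.1 h1 _ (Finset.mem_univ _)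
    · exact ih c hc

variable [Fintype R] [DecidableEq X]

theorem sum_prod_mul_apply {P : R → X → ℝ} (hP1 : ∀ x, ∑ r : R, P r x = 1) (x₀ : X)
    (g : R → ℝ) :
    ∑ v : X → R, (∏ x : X, P (v x) x) * g (v x₀) = ∑ r : R, P r x₀ * g r := by
  have h1 : ∀ v : X → R, (∏ x : X, P (v x) x) * g (v x₀) =
      ∏ x : X, P (v x) x * (if x = x₀ then g (v x) else 1) := by
    intro v
    rw [Finset.prod_mul_distrib, Finset.prod_ite_eq' Finset.univ x₀ fun x => g (v x)]
    simp
  rw [Finset.sum_congr rfl fun v _ => h1 v,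
    ← Fintype.prod_sum fun (x : X) (r : R) => P r x * (if x = x₀ then g r else 1),
    Fintype.prod_eq_single x₀]
  · simp
  · intro x hx
    simp [hx, hP1]

theorem sum_tableWeight {P : R → X → ℝ} (hP1 : ∀ x, ∑ r : R, P r x = 1) (T : ℕ) :
    ∑ ω : Fin T → X → R, tableWeight P ω = 1 := by
  have h : ∑ v : X → R, ∏ x : X, P (v x) x = 1 := by
    rw [← Fintype.prod_sum fun (x : X) (r : R) => P r x]
    simp [hP1]
  simp only [tableWeight]
  rw [← Fintype.prod_sum fun (_ : Fin T) (v : X → R) => ∏ x : X, P (v x) x]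
  simp [h]

/-- A supermartingale function of the history has expectation at most its initial value. -/
theorem sum_tableWeight_mul_le {P : R → X → ℝ} (hP0 : ∀ r x, 0 ≤ P r x)
    (hP1 : ∀ x, ∑ r : R, P r x = 1) {T : ℕ} (π : List (X × R) → X) (F : List (X × R) → ℝ)
    (hF : ∀ h x, ∑ r : R, P r x * F (h ++ [(x, r)]) ≤ F h) (n : ℕ) (hn : n ≤ T) :
    ∑ ω : Fin T → X → R, tableWeight P ω * F (histT π ω n) ≤ F [] := by
  induction T generalizing π F n with
  | zero =>
    obtain rfl : n = 0 := by omega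
    simp [histT, tableWeight]
  | succ T ih =>
    rcases n with _ | n
    · simp only [histT]
      rw [← Finset.sum_mul, sum_tableWeight hP1, one_mul]
    rw [← (Fin.consEquiv fun _ : Fin (T + 1) => X → R).sum_comp, Fintype.sum_prod_type]
    calc ∑ v : X → R, ∑ ω : Fin T → X → R,
          tableWeight P (Fin.cons v ω : Fin (T + 1) → X → R) *
            F (histT π (Fin.cons v ω : Fin (T + 1) → X → R) (n + 1))
        = ∑ v : X → R, (∏ x : X, P (v x) x) * ∑ ω : Fin T → X → R, tableWeight P ω *
            F ((π [], v (π [])) :: histT (fun h => π ((π [], v (π [])) :: h)) ω n) := by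
          refine Finset.sum_congr rfl fun v _ => ?_
          rw [Finset.mul_sum]
          refine Finset.sum_congr rfl fun ω _ => ?_
          rw [histT_cons, tableWeight, Fin.prod_univ_succ, ← mul_assoc]
          simp only [Fin.cons_zero, Fin.cons_succ, tableWeight]
      _ ≤ ∑ v : X → R, (∏ x : X, P (v x) x) * F [(π [], v (π []))] := by
          gcongr with v
          · exact Finset.prod_nonneg fun _ _ => hP0 _ _
          · exact ih (fun h => π ((π [], v (π [])) :: h)) (fun h => F ((π [], v (π [])) :: h))
              (fun h x => hF ((π [], v (π [])) :: h) x) n (by omega)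
      _ = ∑ r : R, P r (π []) * F ([] ++ [(π [], r)]) :=
          sum_prod_mul_apply hP1 (π []) fun r => F [(π [], r)]
      _ ≤ F [] := hF [] (π [])

end Expectation

theorem mul_infoDiv_eq_countDiv {R : Type*} [Fintype R] {Q : R → ℝ} (hQ0 : ∀ r, 0 ≤ Q r)
    (hQ1 : ∑ r, Q r = 1) {n : R → ℕ} (hn : ∀ r, n r ≠ 0 → 0 < Q r) {N : ℕ} (hN : ∑ r, n r = N) :
    ((N : ℝ) : EReal) * infoDiv (fun r => (n r : ℝ) / N) Q =
      (countDiv Q (Finset.univ.filter fun r => 0 < Q r) n : ℝ) := by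
  have hz : ∀ r, ¬ 0 < Q r → n r = 0 := fun r h => by_contra fun h' => h (hn r h')
  have hsum : ∑ r, (n r : ℝ) = N := by exact_mod_cast hN
  have f1 : ∑ r with 0 < Q r, (n r : ℝ) * Real.log (n r / Q r) =
      ∑ r, (n r : ℝ) * Real.log (n r / Q r) :=
    Finset.sum_filter_of_ne fun r _ h => hn r fun h0 => h (by simp [h0])
  have f2 : ∑ r with 0 < Q r, (n r : ℝ) = N := by
    rw [← hsum]
    exact Finset.sum_filter_of_ne fun r _ h => hn r (by exact_mod_cast h)
  have f3 : ∑ r with 0 < Q r, Q r = 1 := by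
    rw [← hQ1]
    exact Finset.sum_filter_of_ne fun r _ h => (hQ0 r).lt_of_ne' h
  rw [infoDiv, if_pos fun r hr => by simp [hz r (by simp [hr])], ← EReal.coe_mul,
    EReal.coe_eq_coe_iff, countDiv, f1, f2, f3, div_one]
  rcases N.eq_zero_or_pos with rfl | hNpos
  · have : ∀ r, n r = 0 := by simpa using hN
    simp [this]
  have hN0 : (N : ℝ) ≠ 0 := by exact_mod_cast hNpos.ne'
  have key : ∀ r, (N : ℝ) * ((n r : ℝ) / N * Real.log (n r / N / Q r) - n r / N + Q r) =
      n r * Real.log (n r / Q r) - n r * Real.log N - n r + N * Q r := by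
    intro r
    rcases Nat.eq_zero_or_pos (n r) with h | h
    · simp [h]
    have h0 : (n r : ℝ) ≠ 0 := by exact_mod_cast h.ne'
    have hQ := (hn r h.ne').ne'
    rw [div_div, Real.log_div h0 (mul_ne_zero hN0 hQ), Real.log_mul hN0 hQ, Real.log_div h0 hQ]
    field_simp
    ring
  rw [Finset.mul_sum, Finset.sum_congr rfl fun r _ => key r, Finset.sum_add_distrib,
    Finset.sum_sub_distrib, Finset.sum_sub_distrib, ← Finset.sum_mul, ← Finset.mul_sum, hsum, hQ1]
  ring

section Counts

variable {R X : Type*} [DecidableEq R] [DecidableEq X]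

/-- The number of occurrences of reward `r` on arm `x` in a history. -/
def histCount (h : List (X × R)) (x : X) (r : R) : ℕ :=
  (h.filter fun p => p = (x, r)).length

theorem histCount_append_self (h : List (X × R)) (x : X) (r : R) :
    histCount (h ++ [(x, r)]) x = histCount h x + Pi.single r 1 := by
  ext s
  by_cases hs : s = r
  · subst hs
    simp [histCount]
  · simp [histCount, hs, Ne.symm hs]

theorem histCount_append_of_ne (h : List (X × R)) {x y : X} (hxy : y ≠ x) (r : R) :
    histCount (h ++ [(x, r)]) y = histCount h y := by
  ext s
  simp [histCount, hxy.symm]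

theorem sum_histCount [Fintype R] (h : List (X × R)) (x : X) :
    ∑ r : R, histCount h x r = (h.filter fun p => p.1 = x).length := by
  induction h with
  | nil => simp [histCount]
  | cons c h ih =>
    have hc : ∀ r, histCount (c :: h) x r = (if c = (x, r) then 1 else 0) + histCount h x r := by
      intro r
      by_cases hcr : c = (x, r) <;> simp [histCount, hcr, add_comm]
    rw [Finset.sum_congr rfl fun r _ => hc r, Finset.sum_add_distrib, ih]
    obtain ⟨y, s⟩ := c
    by_cases hy : y = x <;> simp [hy, add_comm]

theorem pos_of_histCount_ne_zero {P : R → X → ℝ} {h : List (X × R)}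
    (hh : ∀ c ∈ h, 0 < P c.2 c.1) {x : X} {r : R} (hr : histCount h x r ≠ 0) : 0 < P r x := by
  obtain ⟨c, hc⟩ := List.exists_mem_of_length_pos (Nat.pos_of_ne_zero hr)
  obtain ⟨hc1, hc2⟩ := List.mem_filter.1 hc
  have := hh c hc1
  rw [of_decide_eq_true hc2] at this
  exact this

end Counts

theorem tableMeasure_le_sum {R X : Type*} [Fintype R] [Fintype X] [DecidableEq X]
    {P : R → X → ℝ} (hP0 : ∀ r x, 0 ≤ P r x) {T : ℕ} (E : Set (Fin T → X → R))
    (f : (Fin T → X → R) → ℝ) (hf0 : ∀ ω, 0 ≤ f ω)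
    (hf : ∀ ω ∈ E, tableWeight P ω ≠ 0 → 1 ≤ f ω) :
    tableMeasure P T E ≤ ENNReal.ofReal (∑ ω, tableWeight P ω * f ω) := by
  have hw : ∀ ω : Fin T → X → R,
      ∏ t : Fin T, ∏ x : X, ENNReal.ofReal (P (ω t x) x) = ENNReal.ofReal (tableWeight P ω) := by
    intro ω
    rw [tableWeight, ENNReal.ofReal_prod_of_nonneg fun _ _ => Finset.prod_nonneg fun _ _ => hP0 _ _]
    refine Finset.prod_congr rfl fun s _ => ?_
    rw [ENNReal.ofReal_prod_of_nonneg fun _ _ => hP0 _ _]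
  rw [tableMeasure, Measure.finsetSum_apply,
    ENNReal.ofReal_sum_of_nonneg fun ω _ => mul_nonneg (tableWeight_nonneg hP0 ω) (hf0 ω)]
  refine Finset.sum_le_sum fun ω _ => ?_
  rw [Measure.smul_apply, @Measure.dirac_apply' _ ⊤ E ω trivial, hw, smul_eq_mul,
    ENNReal.ofReal_mul (tableWeight_nonneg hP0 ω)]
  by_cases hω : ω ∈ E
  · by_cases h0 : tableWeight P ω = 0
    · simp [h0]
    · gcongr
      simpa [hω] using hf ω hω h0
  · simp [hω]

theorem coe_sum_real {ι : Type*} (s : Finset ι) (f : ι → ℝ) :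
    ((∑ i ∈ s, f i : ℝ) : EReal) = ∑ i ∈ s, (f i : EReal) :=
  map_sum (⟨⟨Real.toEReal, EReal.coe_zero⟩, EReal.coe_add⟩ : ℝ →+ EReal) f s

/-- Markov's inequality for the product over the arms of the multinomial supermartingales. -/
theorem tableMeasure_infoDiv_le
    {R X : Type*} [Fintype R] [Fintype X] [DecidableEq R] [DecidableEq X]
    {P : R → X → ℝ} (hP0 : ∀ r x, 0 ≤ P r x) (hP1 : ∀ x, ∑ r : R, P r x = 1)
    (π : List (X × R) → X) {t : ℕ} (ht : 1 ≤ t) {δ c C : ℝ} (hc : 0 ≤ c) (hC : 1 ≤ C)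
    (hB : BernoulliDeviationBound c C t) :
    tableMeasure P t {ω : Fin t → X → R |
        ((δ : ℝ) : EReal) ≤ ∑ x : X, ((pullsT π ω t x : ℝ) : EReal) *
          infoDiv (fun r => empT π ω t r x) (fun r => P r x)} ≤
      ENNReal.ofReal (C ^ (Fintype.card X * (Fintype.card R - 1)) * Real.exp (-(c * δ))) := by
  have hS : ∀ x, (Finset.univ.filter fun r => 0 < P r x).Nonempty := by
    intro x
    obtain ⟨r, -, hr⟩ := Finset.exists_ne_zero_of_sum_ne_zero
      (show ∑ r : R, P r x ≠ 0 by rw [hP1]; exact one_ne_zero)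
    exact ⟨r, by simpa using (hP0 r x).lt_of_ne' hr⟩
  have hSsum : ∀ x (g : R → ℝ), ∑ r with 0 < P r x, P r x * g r = ∑ r, P r x * g r :=
    fun x g => Finset.sum_filter_of_ne fun r _ h => (hP0 r x).lt_of_ne' (left_ne_zero_of_mul h)
  choose G hG0 _ hGstep hGzero hGexp using fun x =>
    hB.exists_multinomial hC (fun r => P r x) (hS x) (by simp)
  let F : List (X × R) → ℝ := fun h => ∏ x, G x (histCount h x)
  have hF0 : ∀ h, 0 ≤ F h := fun h => Finset.prod_nonneg fun x _ => hG0 x _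
  have hF : ∀ h x, ∑ r : R, P r x * F (h ++ [(x, r)]) ≤ F h := by
    intro h x
    have hsplit : ∀ r, F (h ++ [(x, r)]) = G x (histCount h x + Pi.single r 1) *
        ∏ y ∈ Finset.univ.erase x, G y (histCount h y) := by
      intro r
      simp only [F]
      rw [← Finset.mul_prod_erase _ _ (Finset.mem_univ x), histCount_append_self]
      congr 1
      exact Finset.prod_congr rfl fun y hy => by
        rw [histCount_append_of_ne h (Finset.ne_of_mem_erase hy)]
    have hone : ∑ r with 0 < P r x, P r x = 1 := by simpa [hP1] using hSsum x fun _ => 1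
    have hstep : ∑ r, P r x * G x (histCount h x + Pi.single r 1) ≤ G x (histCount h x) :=
      (hSsum x _).symm.trans_le ((hGstep x (histCount h x)).trans_eq
        ((congrArg (· * G x (histCount h x)) hone).trans (one_mul _)))
    simp only [hsplit, ← mul_assoc]
    rw [← Finset.sum_mul]
    refine (mul_le_mul_of_nonneg_right hstep (Finset.prod_nonneg fun y _ => hG0 y _)).trans_eq ?_
    exact Finset.mul_prod_erase _ (fun y => G y (histCount h y)) (Finset.mem_univ x)
  have hFnil : F [] ≤ C ^ (Fintype.card X * (Fintype.card R - 1)) := by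
    calc F [] ≤ ∏ _x : X, C ^ (Fintype.card R - 1) :=
          Finset.prod_le_prod (fun x _ => hG0 x _) fun x _ => (hGzero x).trans
            (pow_le_pow_right₀ hC (Nat.sub_le_sub_right (Finset.card_le_univ _) 1))
      _ = _ := by rw [Finset.prod_const, Finset.card_univ, ← pow_mul, mul_comm]
  refine (tableMeasure_le_sum hP0 _ (fun ω => F (histT π ω (t - 1)) * Real.exp (-(c * δ)))
    (fun ω => mul_nonneg (hF0 _) (Real.exp_pos _).le) ?_).trans ?_
  · intro ω hω hwω
    have hpos := pos_of_mem_histT hP0 π hwω (t - 1)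
    set h := histT π ω (t - 1) with hh
    have hpulls : ∀ x, ∑ r, histCount h x r = pullsT π ω t x := fun x => sum_histCount h x
    have hterm : ∀ x, ((pullsT π ω t x : ℝ) : EReal) *
        infoDiv (fun r => empT π ω t r x) (fun r => P r x) =
        (countDiv (fun r => P r x) (Finset.univ.filter fun r => 0 < P r x) (histCount h x) : ℝ) :=
      fun x => mul_infoDiv_eq_countDiv (fun r => hP0 r x) (hP1 x)
        (fun r hr => pos_of_histCount_ne_zero hpos hr) (hpulls x)
    have hω' : δ ≤ ∑ x, countDiv (fun r => P r x) (Finset.univ.filter fun r => 0 < P r x)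
        (histCount h x) := by
      have hle : (δ : EReal) ≤ _ := hω
      rw [Finset.sum_congr rfl fun x _ => hterm x, ← coe_sum_real] at hle
      exact EReal.coe_le_coe_iff.1 hle
    have hlen : ∀ x, ∑ r with 0 < P r x, histCount h x r < t := by
      intro x
      calc ∑ r with 0 < P r x, histCount h x r ≤ ∑ r, histCount h x r :=
            Finset.sum_le_sum_of_subset (Finset.filter_subset _ _)
        _ = (h.filter fun p => p.1 = x).length := sum_histCount h x
        _ ≤ h.length := List.length_filter_le _ _
        _ ≤ t - 1 := histT_length_le π ω (t - 1)
        _ < t := by omega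
    have hexp : Real.exp (c * δ) ≤ F h := by
      calc Real.exp (c * δ) ≤ Real.exp (∑ x, c * countDiv (fun r => P r x)
            (Finset.univ.filter fun r => 0 < P r x) (histCount h x)) := by
            rw [← Finset.mul_sum]
            exact Real.exp_le_exp.2 (mul_le_mul_of_nonneg_left hω' hc)
        _ ≤ _ := by
            rw [Real.exp_sum]
            exact Finset.prod_le_prod (fun x _ => (Real.exp_pos _).le)
              fun x _ => hGexp x _ (hlen x)
    calc (1 : ℝ) = Real.exp (c * δ) * Real.exp (-(c * δ)) := by rw [← Real.exp_add]; simp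
      _ ≤ _ := mul_le_mul_of_nonneg_right hexp (Real.exp_pos _).le
  · refine ENNReal.ofReal_le_ofReal ?_
    simp only [← mul_assoc]
    rw [← Finset.sum_mul]
    exact mul_le_mul_of_nonneg_right
      ((sum_tableWeight_mul_le hP0 hP1 π F hF (t - 1) (by omega)).trans hFnil) (Real.exp_pos _).le

theorem exists_bernoulliDeviationBound {c : ℝ} (hc0 : 0 ≤ c) (hc1 : c < 1) (T : ℕ) :
    ∃ C, 1 ≤ C ∧ BernoulliDeviationBound c C T := by
  have h1 : 0 < 1 + c := by linarith
  have hρ : 1 < 2 / (1 + c) := (one_lt_div h1).2 (by linarith)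
  have hμ0 : 0 ≤ 2 * c / (1 + c) := by positivity
  have hμ1 : 2 * c / (1 + c) < 1 := (div_lt_one h1).2 (by linarith)
  obtain ⟨D, hD⟩ := pow_unbounded_of_one_lt (T : ℝ) hρ
  have hD' : (T : ℝ) ≤ (2 / (1 + c)) ^ (D + 1) :=
    hD.le.trans (pow_le_pow_right₀ hρ.le (Nat.le_succ D))
  have hB := bernoulliDeviationBound_of_le_pow hμ0 hμ1 hρ D.succ_pos hD'
  have hdiv : 2 * c / (1 + c) / (2 / (1 + c)) = c := by field_simp
  rw [hdiv] at hB
  refine ⟨_, ?_, hB⟩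
  rw [one_le_div (by linarith)]
  have : (0 : ℝ) ≤ D := Nat.cast_nonneg D
  push_cast
  linarith

theorem le_pow_of_log_mul_le {δ : ℝ} (hδ : 1 < δ) {t D : ℕ} (ht : 1 ≤ t)
    (hD : Real.log t * δ ≤ D) : (t : ℝ) ≤ (δ / (δ - 1)) ^ D := by
  have ht0 : (0 : ℝ) < t := by exact_mod_cast ht
  have h1 : 0 < δ - 1 := by linarith
  have hρ : 0 < δ / (δ - 1) := div_pos (by linarith) h1
  have hlog : 1 / δ ≤ Real.log (δ / (δ - 1)) := by
    have := Real.one_sub_inv_le_log_of_pos hρ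
    have e : 1 - (δ / (δ - 1))⁻¹ = 1 / δ := by field_simp; ring
    rwa [e] at this
  rw [← Real.log_le_log_iff ht0 (pow_pos hρ D), Real.log_pow]
  calc Real.log t ≤ D * (1 / δ) := by
        rw [mul_one_div, le_div_iff₀ (by linarith)]
        exact hD
    _ ≤ _ := mul_le_mul_of_nonneg_left hlog (Nat.cast_nonneg D)

/-- concentration bound for the information distance: for every
`δ ≥ |X|·(|𝔯|−1) + 1` and every round `t ≥ 1`,
`Prob(Σ_x N_t(x)·I(P_t(x), P(x)) ≥ δ) ≤
  e·(δ·⌈log(t)·δ+1⌉·2e/(|X|(|𝔯|−1)))^{|X|(|𝔯|−1)}·exp(−δ)`. -/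
theorem concentration_info
    {R X : Type*} [Fintype R] [Fintype X] [Nonempty X] [Nonempty R]
    [DecidableEq R] [DecidableEq X]
    (P : R → X → ℝ) (hP0 : ∀ r x, 0 ≤ P r x) (hP1 : ∀ x, ∑ r : R, P r x = 1)
    (π : List (X × R) → X) (t : ℕ) (ht : 1 ≤ t) (δ : ℝ)
    (hδ : (Fintype.card X : ℝ) * ((Fintype.card R : ℝ) - 1) + 1 ≤ δ) :
    tableMeasure P t {ω : Fin t → X → R |
        ((δ : ℝ) : EReal) ≤ ∑ x : X, ((pullsT π ω t x : ℝ) : EReal) *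
          infoDiv (fun r => empT π ω t r x) (fun r => P r x)} ≤
      ENNReal.ofReal (Real.exp 1 *
        (δ * ((⌈Real.log (t : ℝ) * δ + 1⌉ : ℤ) : ℝ) * 2 * Real.exp 1 /
            ((Fintype.card X : ℝ) * ((Fintype.card R : ℝ) - 1))) ^
          (Fintype.card X * (Fintype.card R - 1)) *
        Real.exp (-δ)) := by
  have hR : 1 ≤ Fintype.card R := Fintype.card_pos
  have hcast : (Fintype.card X : ℝ) * ((Fintype.card R : ℝ) - 1) =
      ((Fintype.card X * (Fintype.card R - 1) : ℕ) : ℝ) := by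
    push_cast [Nat.cast_sub hR]
    ring
  rw [hcast] at hδ ⊢
  have key := fun (c C : ℝ) (hc : 0 ≤ c) (hC : 1 ≤ C) (hB : BernoulliDeviationBound c C t) =>
    tableMeasure_infoDiv_le (δ := δ) hP0 hP1 π ht hc hC hB
  set d : ℕ := Fintype.card X * (Fintype.card R - 1)
  clear_value d
  rcases Nat.eq_zero_or_pos d with rfl | hd
  · have hδ1 : 1 ≤ δ := by simpa using hδ
    have hδ0 : 0 < δ := by linarith
    have hc0 : 0 ≤ 1 - 1 / δ := sub_nonneg.2 ((div_le_one hδ0).2 hδ1)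
    obtain ⟨C, hC, hB⟩ := exists_bernoulliDeviationBound hc0
      (sub_lt_self 1 (one_div_pos.2 hδ0)) t
    refine (key _ C hc0 hC hB).trans_eq ?_
    have : -((1 - 1 / δ) * δ) = 1 + -δ := by field_simp; ring
    rw [this, Real.exp_add]
    simp
  have hd1 : (1 : ℝ) ≤ d := by exact_mod_cast hd
  have hd0 : (0 : ℝ) < d := by linarith
  have hδ1 : 0 < δ - 1 := by linarith
  have hδ0 : 0 < δ := by linarith
  have hlog : 0 ≤ Real.log (t : ℝ) * δ :=
    mul_nonneg (Real.log_nonneg (by exact_mod_cast ht)) hδ0.le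
  obtain ⟨D, hD⟩ := Int.eq_ofNat_of_zero_le
    (Int.ceil_nonneg (by linarith : 0 ≤ Real.log (t : ℝ) * δ + 1))
  have hDle : Real.log (t : ℝ) * δ + 1 ≤ D := by
    have := Int.le_ceil (Real.log (t : ℝ) * δ + 1)
    rwa [hD, Int.cast_natCast] at this
  have hD1 : (1 : ℝ) ≤ D := by linarith
  rw [hD, Int.cast_natCast]
  have hμ0 : 0 ≤ 1 - d / (δ - 1) := sub_nonneg.2 ((div_le_one hδ1).2 (by linarith))
  have hμ1 : 1 - d / (δ - 1) < 1 := sub_lt_self 1 (div_pos hd0 hδ1)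
  have hρ : 1 < δ / (δ - 1) := (one_lt_div hδ1).2 (by linarith)
  have hB := bernoulliDeviationBound_of_le_pow hμ0 hμ1 hρ (by exact_mod_cast hD1)
    (le_pow_of_log_mul_le (by linarith) ht (by linarith : Real.log (t : ℝ) * δ ≤ D))
  have hCeq : 2 * D / (1 - (1 - d / (δ - 1))) = 2 * D * (δ - 1) / d := by
    rw [sub_sub_cancel, div_div_eq_mul_div]
  rw [hCeq] at hB
  have hC : 1 ≤ 2 * D * (δ - 1) / d := by
    rw [one_le_div hd0]
    nlinarith
  refine (key _ _ (div_nonneg hμ0 (by linarith)) hC hB).trans (ENNReal.ofReal_le_ofReal ?_)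
  have hexp : -((1 - d / (δ - 1)) / (δ / (δ - 1)) * δ) = 1 + d * 1 + -δ := by
    field_simp
    ring
  rw [hexp, Real.exp_add, Real.exp_add, Real.exp_nat_mul]
  calc (2 * D * (δ - 1) / d) ^ d * (Real.exp 1 * Real.exp 1 ^ d * Real.exp (-δ))
      = Real.exp 1 * (2 * D * (δ - 1) / d * Real.exp 1) ^ d * Real.exp (-δ) := by
        rw [mul_pow]
        ring
    _ ≤ Real.exp 1 * (δ * D * 2 * Real.exp 1 / d) ^ d * Real.exp (-δ) := by
        have hbase : 2 * D * (δ - 1) / d * Real.exp 1 ≤ δ * D * 2 * Real.exp 1 / d := by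
          rw [div_mul_eq_mul_div]
          gcongr ?_ / _
          nlinarith [mul_pos (zero_lt_one.trans_le hD1) (Real.exp_pos 1)]
        gcongr

end Bandit
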